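/- arXiv:2410.08506 — 2 statements merged into one kernel-verified Lean document; each statement's English description precedes it below -/
import Mathlib

section
/- For every alternating trilinear form T on ℝ^n and all u, v, w ∈ ℝ^n, Tr( c(u) c(v) c(w) ∑_{(i,s,t)} T(e_i,e_s,e_t) c(e_i) ĉ(e_s) ĉ(e_t) ) = 0, where the sum runs over all triples (i,s,t) of pairwise distinct indices in {1,…,n}. -/
open MeasureTheory

noncomputable section

/-- Euclidean space `ℝ^n` with its standard inner product. -/
abbrev Eucl (n : ℕ) := EuclideanSpace ℝ (Fin n)

/-- The exterior algebra `Λℝ^n`. -/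
abbrev ExtAlg (n : ℕ) := ExteriorAlgebra ℝ (Eucl n)

/-- The standard orthonormal basis vector `e_i` of `ℝ^n`. -/
def e (n : ℕ) (i : Fin n) : Eucl n := EuclideanSpace.single i 1

/-- Left exterior multiplication `ε(x)` on `Λℝ^n`. -/
def eps {n : ℕ} (x : Eucl n) : Module.End ℝ (ExtAlg n) :=
  LinearMap.mulLeft ℝ (ExteriorAlgebra.ι ℝ x)

/-- Interior multiplication (contraction) `ι(x)` on `Λℝ^n`, determined by the inner product. -/
def iot {n : ℕ} (x : Eucl n) : Module.End ℝ (ExtAlg n) :=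
  CliffordAlgebra.contractLeft (Q := (0 : QuadraticForm ℝ (Eucl n))) (innerSL ℝ x).toLinearMap

/-- The Clifford action `c(x) = ε(x) − ι(x)`. -/
def c {n : ℕ} (x : Eucl n) : Module.End ℝ (ExtAlg n) := eps x - iot x

/-- The Clifford action `ĉ(x) = ε(x) + ι(x)`. -/
def hc {n : ℕ} (x : Eucl n) : Module.End ℝ (ExtAlg n) := eps x + iot x

/-- The trace of a linear endomorphism of `Λℝ^n`. -/
def Tr {n : ℕ} : Module.End ℝ (ExtAlg n) →ₗ[ℝ] ℝ := LinearMap.trace ℝ (ExtAlg n)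

theorem eps_mul_eps {n : ℕ} (x y : Eucl n) : eps x * eps y = -(eps y * eps x) := by
  refine LinearMap.ext fun a ↦ ?_
  have h := eq_neg_of_add_eq_zero_left (ExteriorAlgebra.ι_add_mul_swap (R := ℝ) x y)
  simp only [eps, Module.End.mul_apply, LinearMap.neg_apply, LinearMap.mulLeft_apply]
  rw [← mul_assoc, h, neg_mul, mul_assoc]

theorem iot_mul_iot {n : ℕ} (x y : Eucl n) : iot x * iot y = -(iot y * iot x) := by
  refine LinearMap.ext fun a ↦ ?_
  exact CliffordAlgebra.contractLeft_comm _ _ a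

theorem iot_mul_eps {n : ℕ} (x y : Eucl n) :
    iot x * eps y = inner ℝ x y • (1 : Module.End ℝ (ExtAlg n)) - eps y * iot x := by
  refine LinearMap.ext fun a ↦ ?_
  exact CliffordAlgebra.contractLeft_ι_mul _ _ _

theorem c_mul_hc {n : ℕ} (x y : Eucl n) : c x * hc y = -(hc y * c x) := by
  simp only [c, hc, mul_add, add_mul, mul_sub, sub_mul, iot_mul_eps, eps_mul_eps x y,
    iot_mul_iot x y, real_inner_comm x y]
  abel

theorem hc_mul_hc {n : ℕ} {x y : Eucl n} (h : inner ℝ x y = 0) :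
    hc x * hc y = -(hc y * hc x) := by
  have h' : inner ℝ y x = 0 := by rw [real_inner_comm, h]
  simp only [hc, mul_add, add_mul, iot_mul_eps, eps_mul_eps x y, iot_mul_iot x y, h, h', zero_smul]
  abel

/-- If `a` commutes with `x`, and `x` anticommutes with `y`, then `a * (x * y)` is traceless. -/
theorem trace_mul_eq_zero_of_anticommute {M : Type*} [AddCommGroup M] [Module ℝ M]
    {a x y : Module.End ℝ M} (ha : Commute a x) (h : x * y = -(y * x)) :
    LinearMap.trace ℝ M (a * (x * y)) = 0 := by
  have key : LinearMap.trace ℝ M (a * (x * y)) = -LinearMap.trace ℝ M (a * (x * y)) := by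
    calc LinearMap.trace ℝ M (a * (x * y)) = LinearMap.trace ℝ M (x * (a * y)) := by
          rw [← mul_assoc, ha.eq, mul_assoc]
      _ = LinearMap.trace ℝ M (a * y * x) := LinearMap.trace_mul_comm ℝ _ _
      _ = -LinearMap.trace ℝ M (a * (x * y)) := by
          rw [h, mul_assoc, mul_neg, map_neg, neg_neg]
  linarith

theorem commute_mul_of_anticommute {R : Type*} [Ring R] {a b z : R} (ha : a * z = -(z * a))
    (hb : b * z = -(z * b)) : Commute (a * b) z := by
  rw [Commute, SemiconjBy, mul_assoc, hb, mul_neg, ← mul_assoc, ha, neg_mul, neg_neg, mul_assoc]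

theorem commute_c_mul_c_hc {n : ℕ} (x y z : Eucl n) : Commute (c x * c y) (hc z) :=
  commute_mul_of_anticommute (c_mul_hc x z) (c_mul_hc y z)

theorem stmt_5 (n : ℕ) (hn : 0 < n) (T : Eucl n [⋀^Fin 3]→ₗ[ℝ] ℝ) (u v w : Eucl n) :
    Tr (c u * c v * c w * ∑ i : Fin n, ∑ s : Fin n, ∑ t : Fin n,
        if i ≠ s ∧ i ≠ t ∧ s ≠ t then
          T ![e n i, e n s, e n t] • (c (e n i) * hc (e n s) * hc (e n t)) else 0)
      = 0 := by
  simp only [Finset.mul_sum, map_sum]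
  refine Finset.sum_eq_zero fun i _ ↦ Finset.sum_eq_zero fun s _ ↦ Finset.sum_eq_zero fun t _ ↦ ?_
  split_ifs with h
  · have hst : inner ℝ (e n s) (e n t) = 0 := by
      simp [e, EuclideanSpace.inner_single_left, h.2.2]
    have hA : Commute (c u * c v * (c w * c (e n i))) (hc (e n s)) :=
      (commute_c_mul_c_hc u v _).mul_left (commute_c_mul_c_hc w _ _)
    have := trace_mul_eq_zero_of_anticommute hA (hc_mul_hc hst)
    rw [mul_smul_comm, map_smul]
    simp only [Tr, mul_assoc] at this ⊢
    rw [this, smul_zero]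
  · rw [mul_zero, map_zero]
end
end

section
/- For every alternating trilinear form T on ℝ^n and all u, v, w ∈ ℝ^n, writing N = ∑_{1≤l<s<t≤n} T(e_l,e_s,e_t) c(e_l) c(e_s) c(e_t), one has ∫_{S^{n−1}} Tr( ∑_{i=1}^n ξ_i · c(u) c(v) c(w) N c(e_i) c(ξ) ) dσ(ξ) = −T(u,v,w) · 2^n · vol(S^{n−1}). -/
open MeasureTheory

noncomputable section

/-- The surface measure `σ` on the unit sphere `S^{n-1} ⊆ ℝ^n`. -/
def sphMeasure (n : ℕ) : Measure (Metric.sphere (0 : Eucl n) 1) :=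
  (volume : Measure (Eucl n)).toSphere

/-- The total surface measure `vol(S^{n-1})` of the unit sphere. -/
def volSph (n : ℕ) : ℝ := (sphMeasure n Set.univ).toReal

theorem iot_ι_mul {n : ℕ} (x y : Eucl n) (a : ExtAlg n) :
    iot x (ExteriorAlgebra.ι ℝ y * a) = inner ℝ x y • a - ExteriorAlgebra.ι ℝ y * iot x a :=
  CliffordAlgebra.contractLeft_ι_mul _ y a

theorem iot_iot {n : ℕ} (x y : Eucl n) (a : ExtAlg n) : iot x (iot y a) = -iot y (iot x a) :=
  CliffordAlgebra.contractLeft_comm _ _ a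

theorem c_apply {n : ℕ} (x : Eucl n) (a : ExtAlg n) :
    c x a = ExteriorAlgebra.ι ℝ x * a - iot x a := rfl

theorem sum_smul_c {n : ℕ} {ι : Type*} (s : Finset ι) (r : ι → ℝ) (x : ι → Eucl n) :
    ∑ i ∈ s, r i • c (x i) = c (∑ i ∈ s, r i • x i) := by
  let L : Eucl n →ₗ[ℝ] Module.End ℝ (ExtAlg n) :=
    (LinearMap.mul ℝ (ExtAlg n)).comp (ExteriorAlgebra.ι ℝ) -
      CliffordAlgebra.contractLeft.comp (innerₗ (Eucl n))
  have hL (y : Eucl n) : c y = L y := rfl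
  simp only [hL, map_sum, map_smul]

theorem c_mul_add_mul_c {n : ℕ} (x y : Eucl n) :
    c x * c y + c y * c x = (-2 * inner ℝ x y) • (1 : Module.End ℝ (ExtAlg n)) := by
  refine LinearMap.ext fun a => ?_
  have hι : ExteriorAlgebra.ι ℝ x * (ExteriorAlgebra.ι ℝ y * a) +
      ExteriorAlgebra.ι ℝ y * (ExteriorAlgebra.ι ℝ x * a) = 0 := by
    rw [← mul_assoc, ← mul_assoc, ← add_mul, ExteriorAlgebra.ι_add_mul_swap, zero_mul]
  simp only [LinearMap.add_apply, Module.End.mul_apply, c_apply, map_sub, iot_ι_mul, LinearMap.smul_apply,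
    Module.End.one_apply, iot_iot x y, real_inner_comm x y]
  linear_combination (norm := module) hι

theorem Tr_one (n : ℕ) : Tr (1 : Module.End ℝ (ExtAlg n)) = 2 ^ n := by
  let b := (EuclideanSpace.basisFun (Fin n) ℝ).toBasis.ExteriorAlgebra
  have : Module.Free ℝ (ExtAlg n) := .of_basis b
  have : Module.Finite ℝ (ExtAlg n) := .of_basis b
  simp [Tr, LinearMap.trace_one, Module.finrank_eq_card_basis b]

theorem Tr_mul_comm {n : ℕ} (A B : Module.End ℝ (ExtAlg n)) : Tr (A * B) = Tr (B * A) :=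
  LinearMap.trace_mul_comm ℝ A B

theorem Tr_c_mul_c {n : ℕ} (x y : Eucl n) : Tr (c x * c y) = -inner ℝ x y * 2 ^ n := by
  have h := congrArg Tr (c_mul_add_mul_c x y)
  rw [map_add, Tr_mul_comm (c y), map_smul, Tr_one, smul_eq_mul] at h
  linarith

theorem Tr_c_mul_four {n : ℕ} (x y z w : Eucl n) :
    Tr (c x * c y * c z * c w) =
      (inner ℝ x y * inner ℝ z w - inner ℝ x z * inner ℝ y w + inner ℝ x w * inner ℝ y z)
        * 2 ^ n := by
  have h : c x * c y * c z * c w + c y * c z * c w * c x =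
      (c x * c y + c y * c x) * c z * c w - c y * (c x * c z + c z * c x) * c w
        + c y * c z * (c x * c w + c w * c x) := by noncomm_ring
  simp only [c_mul_add_mul_c, smul_mul_assoc, mul_smul_comm, one_mul, mul_one] at h
  have h := congrArg Tr h
  simp only [map_add, map_sub, map_smul, smul_eq_mul, Tr_mul_comm _ (c x), Tr_c_mul_c,
    ← mul_assoc] at h
  linarith

theorem Tr_c_mul_six {n : ℕ} (u v w x y z : Eucl n) (hxy : inner ℝ x y = 0)
    (hxz : inner ℝ x z = 0) (hyz : inner ℝ y z = 0) :
    Tr (c u * c v * c w * (c x * c y * c z)) =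
      (inner ℝ u x * inner ℝ v y * inner ℝ w z + inner ℝ u y * inner ℝ v z * inner ℝ w x
        + inner ℝ u z * inner ℝ v x * inner ℝ w y - inner ℝ u x * inner ℝ v z * inner ℝ w y
        - inner ℝ u y * inner ℝ v x * inner ℝ w z - inner ℝ u z * inner ℝ v y * inner ℝ w x)
        * 2 ^ n := by
  have h : c u * c v * c w * (c x * c y * c z) + c v * c w * c x * c y * c z * c u =
      (c u * c v + c v * c u) * c w * c x * c y * c z
        - c v * (c u * c w + c w * c u) * c x * c y * c z
        + c v * c w * (c u * c x + c x * c u) * c y * c z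
        - c v * c w * c x * (c u * c y + c y * c u) * c z
        + c v * c w * c x * c y * (c u * c z + c z * c u) := by noncomm_ring
  simp only [c_mul_add_mul_c, smul_mul_assoc, mul_smul_comm, one_mul, mul_one] at h
  have h := congrArg Tr h
  simp only [map_add, map_sub, map_smul, smul_eq_mul, Tr_mul_comm _ (c u), Tr_c_mul_four,
    ← mul_assoc, hxy, hxz, hyz] at h
  simp only [← mul_assoc]
  linarith

/-- A triple sum of terms vanishing on the diagonals is a sum over strictly increasing triples of
the six rearranged terms. -/
theorem sum_eq_sum_lt_lt {ι M : Type*} [Fintype ι] [LinearOrder ι] [AddCommMonoid M]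
    (g : ι → ι → ι → M) (h₁₂ : ∀ i k, g i i k = 0) (h₂₃ : ∀ i k, g i k k = 0)
    (h₁₃ : ∀ i k, g i k i = 0) :
    ∑ i, ∑ j, ∑ k, g i j k = ∑ l, ∑ s, ∑ t, if l < s ∧ s < t then
      g l s t + g s t l + g t l s + g l t s + g s l t + g t s l else 0 := by
  have hsplit : ∀ l s t, (if l < s ∧ s < t then
      g l s t + g s t l + g t l s + g l t s + g s l t + g t s l else 0) =
      (if l < s ∧ s < t then g l s t else 0) + (if l < s ∧ s < t then g s t l else 0)
      + (if l < s ∧ s < t then g t l s else 0) + (if l < s ∧ s < t then g l t s else 0)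
      + (if l < s ∧ s < t then g s l t else 0) + (if l < s ∧ s < t then g t s l else 0) := by
    intro l s t
    split_ifs <;> simp
  have swap₁₂ (f : ι → ι → ι → M) : ∑ l, ∑ s, ∑ t, f l s t = ∑ s, ∑ l, ∑ t, f l s t :=
    Finset.sum_comm
  have swap₂₃ (f : ι → ι → ι → M) : ∑ l, ∑ s, ∑ t, f l s t = ∑ l, ∑ t, ∑ s, f l s t :=
    Finset.sum_congr rfl fun _ _ => Finset.sum_comm
  simp only [hsplit, Finset.sum_add_distrib]
  rw [swap₁₂ fun l s t => if l < s ∧ s < t then g s t l else 0,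
    swap₂₃ fun s l t => if l < s ∧ s < t then g s t l else 0,
    swap₂₃ fun l s t => if l < s ∧ s < t then g t l s else 0,
    swap₁₂ fun l t s => if l < s ∧ s < t then g t l s else 0,
    swap₂₃ fun l s t => if l < s ∧ s < t then g l t s else 0,
    swap₁₂ fun l s t => if l < s ∧ s < t then g s l t else 0,
    swap₁₂ fun l s t => if l < s ∧ s < t then g t s l else 0,
    swap₂₃ fun s l t => if l < s ∧ s < t then g t s l else 0,
    swap₁₂ fun s t l => if l < s ∧ s < t then g t s l else 0]
  simp only [← Finset.sum_add_distrib]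
  refine Finset.sum_congr rfl fun i _ => Finset.sum_congr rfl fun j _ =>
    Finset.sum_congr rfl fun k _ => ?_
  rcases lt_trichotomy i j with hij | rfl | hij
  · rcases lt_trichotomy j k with hjk | rfl | hjk
    · simp [hij, hjk, hij.not_gt, hjk.not_gt, (hij.trans hjk).not_gt]
    · simp [h₂₃]
    · rcases lt_trichotomy i k with hik | rfl | hik
      · simp [hij, hjk, hik, hij.not_gt, hjk.not_gt, hik.not_gt]
      · simp [h₁₃]
      · simp [hij, hjk, hik, hij.not_gt, hjk.not_gt, hik.not_gt]
  · simp [h₁₂]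
  · rcases lt_trichotomy j k with hjk | rfl | hjk
    · rcases lt_trichotomy i k with hik | rfl | hik
      · simp [hij, hjk, hik, hij.not_gt, hjk.not_gt, hik.not_gt]
      · simp [h₁₃]
      · simp [hij, hjk, hik, hij.not_gt, hjk.not_gt, hik.not_gt]
    · simp [h₂₃]
    · simp [hij, hjk, hij.not_gt, hjk.not_gt, (hjk.trans hij).not_gt]

theorem sum_smul_e {n : ℕ} (x : Eucl n) : ∑ i, x i • e n i = x := by
  simpa [e] using (EuclideanSpace.basisFun (Fin n) ℝ).sum_repr x

theorem alternating_eq_sum {n : ℕ} (T : Eucl n [⋀^Fin 3]→ₗ[ℝ] ℝ) (u v w : Eucl n) :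
    T ![u, v, w] = ∑ i, ∑ j, ∑ k, u i * v j * w k * T ![e n i, e n j, e n k] := by
  have expand (m : Fin 3 → Eucl n) (p : Fin 3) (x : Eucl n) :
      T (Function.update m p x) = ∑ i, x i * T (Function.update m p (e n i)) := by
    conv_lhs => rw [← sum_smul_e x]
    simpa only [map_smul, MultilinearMap.toLinearMap_apply, AlternatingMap.coe_multilinearMap,
      smul_eq_mul] using
      map_sum (T.toMultilinearMap.toLinearMap m p) (fun i => x i • e n i) Finset.univ
  have h₀ (a b : Eucl n) : T ![u, a, b] = ∑ i, u i * T ![e n i, a, b] := by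
    have update (x : Eucl n) : Function.update ![0, a, b] 0 x = ![x, a, b] := by
      ext i : 1
      fin_cases i <;> rfl
    simpa only [update] using expand ![0, a, b] 0 u
  have h₁ (a b : Eucl n) : T ![a, v, b] = ∑ i, v i * T ![a, e n i, b] := by
    have update (x : Eucl n) : Function.update ![a, 0, b] 1 x = ![a, x, b] := by
      ext i : 1
      fin_cases i <;> rfl
    simpa only [update] using expand ![a, 0, b] 1 v
  have h₂ (a b : Eucl n) : T ![a, b, w] = ∑ i, w i * T ![a, b, e n i] := by
    have update (x : Eucl n) : Function.update ![a, b, 0] 2 x = ![a, b, x] := by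
      ext i : 1
      fin_cases i <;> rfl
    simpa only [update] using expand ![a, b, 0] 2 w
  simp only [h₀, h₁, h₂, Finset.mul_sum, mul_assoc]

theorem Tr_c_mul_alternating {n : ℕ} (T : Eucl n [⋀^Fin 3]→ₗ[ℝ] ℝ) (u v w : Eucl n) :
    Tr (c u * c v * c w * ∑ l : Fin n, ∑ s : Fin n, ∑ t : Fin n,
        if l < s ∧ s < t then
          T ![e n l, e n s, e n t] • (c (e n l) * c (e n s) * c (e n t)) else 0) =
      T ![u, v, w] * 2 ^ n := by
  have hi (x : Eucl n) (i : Fin n) : inner ℝ x (e n i) = x i := by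
    simp [e, EuclideanSpace.inner_single_right]
  have ho {i j : Fin n} (h : i < j) : inner ℝ (e n i) (e n j) = 0 := by
    rw [hi, e, PiLp.single_apply, if_neg h.ne']
  have h₁₂ (a b d : Eucl n) : T ![a, b, d] = -T ![b, a, d] := by
    rw [← T.map_swap _ (show (0 : Fin 3) ≠ 1 by decide)]
    congr 1
    ext i : 1
    fin_cases i <;> rfl
  have h₂₃ (a b d : Eucl n) : T ![a, b, d] = -T ![a, d, b] := by
    rw [← T.map_swap _ (show (1 : Fin 3) ≠ 2 by decide)]
    congr 1
    ext i : 1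
    fin_cases i <;> rfl
  rw [alternating_eq_sum, sum_eq_sum_lt_lt fun i j k => u i * v j * w k * T ![e n i, e n j, e n k],
    Finset.sum_mul, Finset.mul_sum, map_sum]
  · refine Finset.sum_congr rfl fun l _ => ?_
    rw [Finset.sum_mul, Finset.mul_sum, map_sum]
    refine Finset.sum_congr rfl fun s _ => ?_
    rw [Finset.sum_mul, Finset.mul_sum, map_sum]
    refine Finset.sum_congr rfl fun t _ => ?_
    split_ifs with h
    · rw [mul_smul_comm, map_smul, Tr_c_mul_six _ _ _ _ _ _ (ho h.1) (ho (h.1.trans h.2)) (ho h.2),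
        smul_eq_mul]
      simp only [hi]
      have a := h₁₂ (e n s) (e n l) (e n t)
      have b := h₂₃ (e n l) (e n t) (e n s)
      have d := h₂₃ (e n s) (e n t) (e n l)
      have f := h₁₂ (e n t) (e n l) (e n s)
      have g := h₂₃ (e n t) (e n s) (e n l)
      rw [g, f, d, a, b]
      ring
    · simp
  · intro i k
    rw [T.map_eq_zero_of_eq _ (i := 0) (j := 1) rfl (by decide), mul_zero]
  · intro i k
    rw [T.map_eq_zero_of_eq _ (i := 1) (j := 2) rfl (by decide), mul_zero]
  · intro i k
    rw [T.map_eq_zero_of_eq _ (i := 0) (j := 2) rfl (by decide), mul_zero]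

theorem stmt_7 (n : ℕ) (hn : 0 < n) (T : Eucl n [⋀^Fin 3]→ₗ[ℝ] ℝ) (u v w : Eucl n)
    (N : Module.End ℝ (ExtAlg n))
    (hN : N = ∑ l : Fin n, ∑ s : Fin n, ∑ t : Fin n,
        if l < s ∧ s < t then
          T ![e n l, e n s, e n t] • (c (e n l) * c (e n s) * c (e n t)) else 0) :
    (∫ ξ : Metric.sphere (0 : Eucl n) 1,
        Tr (∑ i : Fin n, (ξ : Eucl n) i •
          (c u * c v * c w * N * c (e n i) * ∑ j : Fin n, (ξ : Eucl n) j • c (e n j)))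
        ∂sphMeasure n)
      = -T ![u, v, w] * 2 ^ n * volSph n := by
  have hsum (ξ : Eucl n) : ∑ j, ξ j • c (e n j) = c ξ := by
    rw [sum_smul_c, sum_smul_e]
  have hsq (ξ : Metric.sphere (0 : Eucl n) 1) : c (ξ : Eucl n) * c (ξ : Eucl n) =
      (-1 : ℝ) • (1 : Module.End ℝ (ExtAlg n)) := by
    have h := c_mul_add_mul_c (ξ : Eucl n) ξ
    rw [real_inner_self_eq_norm_sq, norm_eq_of_mem_sphere] at h
    linear_combination (norm := module) (1 / 2 : ℝ) • h
  have key (ξ : Metric.sphere (0 : Eucl n) 1) :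
      Tr (∑ i : Fin n, (ξ : Eucl n) i •
        (c u * c v * c w * N * c (e n i) * ∑ j : Fin n, (ξ : Eucl n) j • c (e n j))) =
      -T ![u, v, w] * 2 ^ n := by
    simp only [hsum, mul_assoc _ _ (c (ξ : Eucl n)), ← mul_smul_comm, ← Finset.mul_sum]
    simp only [mul_smul_comm, ← smul_mul_assoc, ← Finset.sum_mul, hsum]
    rw [hsq, mul_smul_comm, mul_one, map_smul, hN, Tr_c_mul_alternating, smul_eq_mul]
    ring
  simp only [key, integral_const, smul_eq_mul]
  rw [volSph, Measure.real, mul_comm]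
end
end
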